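/- Let G be a binary SSG (every vertex of V_MAX has outdegree exactly 2). If σ and σ' are MAX strategies with v_{σ'} > v_σ, then the set difference S_σ \ S_{σ'} of their switch sets is nonempty (in particular S_σ is not contained in S_{σ'}). -/

import Mathlib

open scoped BigOperators

instance : Fact ((0:ℝ) ≤ 1) := ⟨zero_le_one⟩

/-- A simple stochastic game on a finite vertex set `V`. -/
structure SSG (V : Type*) [Fintype V] [DecidableEq V] where
  /-- MAX vertices -/
  VMax : Finset V
  /-- MIN vertices -/
  VMin : Finset V
  /-- random vertices -/
  VR : Finset V
  /-- sink vertices -/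
  VS : Finset V
  cover : ∀ x : V, x ∈ VMax ∨ x ∈ VMin ∨ x ∈ VR ∨ x ∈ VS
  disjMaxMin : Disjoint VMax VMin
  disjMaxR : Disjoint VMax VR
  disjMaxS : Disjoint VMax VS
  disjMinR : Disjoint VMin VR
  disjMinS : Disjoint VMin VS
  disjRS : Disjoint VR VS
  /-- out-neighbourhood: `y ∈ succ x` iff `(x,y)` is an edge -/
  succ : V → Finset V
  outMax : ∀ x ∈ VMax, 2 ≤ (succ x).card
  outMin : ∀ x ∈ VMin, 2 ≤ (succ x).card
  outR : ∀ x ∈ VR, 1 ≤ (succ x).card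
  /-- transition probabilities at random vertices -/
  prob : V → V → ℝ
  prob_nonneg : ∀ x y, 0 ≤ prob x y
  prob_support : ∀ x ∈ VR, ∀ y, y ∉ succ x → prob x y = 0
  prob_sum : ∀ x ∈ VR, (∑ y, prob x y) = 1
  /-- values of the sinks -/
  val : V → ℝ
  val_mem : ∀ x ∈ VS, val x ∈ Set.Icc (0:ℝ) 1

namespace SSG

variable {V : Type*} [Fintype V] [DecidableEq V]

/-- A positional MAX strategy: a choice of an out-neighbour at every MAX vertex
(normalised to the identity away from `VMax`). -/
structure MaxStrategy (G : SSG V) where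
  toFun : V → V
  mem_succ : ∀ x ∈ G.VMax, toFun x ∈ G.succ x
  eq_id : ∀ x ∉ G.VMax, toFun x = x

/-- A positional MIN strategy. -/
structure MinStrategy (G : SSG V) where
  toFun : V → V
  mem_succ : ∀ x ∈ G.VMin, toFun x ∈ G.succ x
  eq_id : ∀ x ∉ G.VMin, toFun x = x

/-- The one-step (monotone) operator on value vectors associated with `(σ,τ)`. -/
noncomputable def F (G : SSG V) (σ : G.MaxStrategy) (τ : G.MinStrategy)
    (w : V → unitInterval) (x : V) : unitInterval :=
  if _hM : x ∈ G.VMax then w (σ.toFun x)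
  else if _hN : x ∈ G.VMin then w (τ.toFun x)
  else if hR : x ∈ G.VR then
    ⟨∑ y, G.prob x y * (w y : ℝ), by
      constructor
      · exact Finset.sum_nonneg fun y _ =>
          mul_nonneg (G.prob_nonneg x y) (w y).2.1
      · calc (∑ y, G.prob x y * (w y : ℝ)) ≤ ∑ y, G.prob x y :=
              Finset.sum_le_sum fun y _ =>
                mul_le_of_le_one_right (G.prob_nonneg x y) (w y).2.2
          _ = 1 := G.prob_sum x hR⟩
  else ⟨G.val x, G.val_mem x (by
    rcases G.cover x with h | h | h | h
    · exact absurd h _hM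
    · exact absurd h _hN
    · exact absurd h hR
    · exact h)⟩

/-- The value vector `v_{σ,τ}`: the least fixed point (à la Knaster–Tarski) of `F`. -/
noncomputable def value (G : SSG V) (σ : G.MaxStrategy) (τ : G.MinStrategy) :
    V → unitInterval :=
  sInf {w : V → unitInterval | G.F σ τ w ≤ w}

/-- `τ` is a best response to `σ`. -/
def IsBestResponse (G : SSG V) (σ : G.MaxStrategy) (τ : G.MinStrategy) : Prop :=
  ∀ τ' : G.MinStrategy, G.value σ τ ≤ G.value σ τ'

/-- `σ` is an optimal MAX strategy: `v_σ ≥ v_{σ'}` for every MAX strategy `σ'`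
(values being computed against best responses). -/
def IsOptimal (G : SSG V) (σ : G.MaxStrategy) : Prop :=
  ∀ τ : G.MinStrategy, G.IsBestResponse σ τ →
    ∀ σ' : G.MaxStrategy, ∀ τ' : G.MinStrategy, G.IsBestResponse σ' τ' →
      G.value σ' τ' ≤ G.value σ τ

/-- The switch set `S_σ` of `σ`, computed with a best response `τ` to `σ`. -/
def switchSet (G : SSG V) (σ : G.MaxStrategy) (τ : G.MinStrategy) : Set V :=
  {x | x ∈ G.VMax ∧ ∃ y ∈ G.succ x, G.value σ τ x < G.value σ τ y}

/-- `σ'` is a `σ`-switch (w.r.t. a best response `τ` to `σ`). -/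
def IsSwitch (G : SSG V) (σ : G.MaxStrategy) (τ : G.MinStrategy)
    (σ' : G.MaxStrategy) : Prop :=
  σ' ≠ σ ∧
  (∀ x ∈ G.VMax, x ∉ G.switchSet σ τ → σ'.toFun x = σ.toFun x) ∧
  (∀ x ∈ G.switchSet σ τ, σ'.toFun x ≠ σ.toFun x →
    G.value σ τ x < G.value σ τ (σ'.toFun x))

/-- `σ` agrees with `σ₀` on `T`. -/
def AgreesOn (G : SSG V) (T : Set V) (σ₀ σ : G.MaxStrategy) : Prop :=
  ∀ x ∈ T, σ.toFun x = σ₀.toFun x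

/-- `σ` is an optimal MAX strategy of the subgame `G_{|T[σ₀]}`: it agrees with `σ₀` on `T`
and its value vector dominates that of every MAX strategy of `G` agreeing with `σ₀` on `T`. -/
def IsOptimalOn (G : SSG V) (T : Set V) (σ₀ σ : G.MaxStrategy) : Prop :=
  G.AgreesOn T σ₀ σ ∧
  ∀ σ' : G.MaxStrategy, G.AgreesOn T σ₀ σ' →
    ∀ τ τ' : G.MinStrategy, G.IsBestResponse σ τ → G.IsBestResponse σ' τ' →
      G.value σ' τ' ≤ G.value σ τ

/-- `σ'` is a `(σ,T)`-super-switch (w.r.t. a best response `τ` to `σ`): it is obtained from an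
intermediate `σ`-switch `σ''` that only switches inside `T`, by taking an optimal strategy of
the subgame `G_{|T[σ'']}`. -/
def IsSuperSwitch (G : SSG V) (σ : G.MaxStrategy) (τ : G.MinStrategy)
    (T : Set V) (σ' : G.MaxStrategy) : Prop :=
  ∃ σ'' : G.MaxStrategy, G.IsSwitch σ τ σ'' ∧
    (∀ x ∈ G.VMax, x ∉ T → σ''.toFun x = σ.toFun x) ∧
    G.IsOptimalOn T σ'' σ'

/-- A binary SSG: every MAX vertex has outdegree exactly 2. -/
def Binary (G : SSG V) : Prop := ∀ x ∈ G.VMax, (G.succ x).card = 2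

/-- `σb` is the total switch `σ̄` of `σ` (in a binary SSG): it switches to the other
out-neighbour exactly on the switch set of `σ`. -/
def IsTotalSwitch (G : SSG V) (σ : G.MaxStrategy) (τ : G.MinStrategy)
    (σb : G.MaxStrategy) : Prop :=
  (∀ x ∈ G.switchSet σ τ, σb.toFun x ≠ σ.toFun x) ∧
  (∀ x ∈ G.VMax, x ∉ G.switchSet σ τ → σb.toFun x = σ.toFun x)

end SSG

namespace SSG

variable {V : Type*} [Fintype V] [DecidableEq V]

lemma F_max (G : SSG V) (σ : G.MaxStrategy) (τ : G.MinStrategy) (w : V → unitInterval) {x : V}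
    (hx : x ∈ G.VMax) : G.F σ τ w x = w (σ.toFun x) := by
  simp [F, hx]

lemma F_min (G : SSG V) (σ : G.MaxStrategy) (τ : G.MinStrategy) (w : V → unitInterval) {x : V}
    (hx : x ∈ G.VMin) : G.F σ τ w x = w (τ.toFun x) := by
  have h1 : x ∉ G.VMax := fun h => Finset.disjoint_left.1 G.disjMaxMin h hx
  simp [F, hx, h1]

lemma F_rand (G : SSG V) (σ : G.MaxStrategy) (τ : G.MinStrategy) (w : V → unitInterval) {x : V}
    (hx : x ∈ G.VR) : (G.F σ τ w x : ℝ) = ∑ y, G.prob x y * (w y : ℝ) := by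
  have h1 : x ∉ G.VMax := fun h => Finset.disjoint_left.1 G.disjMaxR h hx
  have h2 : x ∉ G.VMin := fun h => Finset.disjoint_left.1 G.disjMinR h hx
  simp [F, hx, h1, h2]

lemma F_sink (G : SSG V) (σ : G.MaxStrategy) (τ : G.MinStrategy) (w : V → unitInterval) {x : V}
    (hx : x ∈ G.VS) : (G.F σ τ w x : ℝ) = G.val x := by
  have h1 : x ∉ G.VMax := fun h => Finset.disjoint_left.1 G.disjMaxS h hx
  have h2 : x ∉ G.VMin := fun h => Finset.disjoint_left.1 G.disjMinS h hx
  have h3 : x ∉ G.VR := fun h => Finset.disjoint_left.1 G.disjRS h hx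
  simp [F, h1, h2, h3]

lemma F_mono (G : SSG V) (σ : G.MaxStrategy) (τ : G.MinStrategy) : Monotone (G.F σ τ) := by
  intro w w' h x
  rcases G.cover x with hx | hx | hx | hx
  · rw [F_max _ _ _ _ hx, F_max _ _ _ _ hx]; exact h _
  · rw [F_min _ _ _ _ hx, F_min _ _ _ _ hx]; exact h _
  · rw [← Subtype.coe_le_coe, F_rand _ _ _ _ hx, F_rand _ _ _ _ hx]
    exact Finset.sum_le_sum fun y _ => mul_le_mul_of_nonneg_left (h y) (G.prob_nonneg x y)
  · rw [← Subtype.coe_le_coe, F_sink _ _ _ _ hx, F_sink _ _ _ _ hx]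

lemma value_fixed (G : SSG V) (σ : G.MaxStrategy) (τ : G.MinStrategy) :
    G.F σ τ (G.value σ τ) = G.value σ τ :=
  OrderHom.map_lfp (⟨G.F σ τ, G.F_mono σ τ⟩ : (V → unitInterval) →o (V → unitInterval))

lemma value_le (G : SSG V) (σ : G.MaxStrategy) (τ : G.MinStrategy) {w : V → unitInterval}
    (h : G.F σ τ w ≤ w) : G.value σ τ ≤ w := sInf_le h

lemma value_max (G : SSG V) (σ : G.MaxStrategy) (τ : G.MinStrategy) {x : V}
    (hx : x ∈ G.VMax) : G.value σ τ x = G.value σ τ (σ.toFun x) := by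
  conv_lhs => rw [← value_fixed, F_max _ _ _ _ hx]

lemma value_min (G : SSG V) (σ : G.MaxStrategy) (τ : G.MinStrategy) {x : V}
    (hx : x ∈ G.VMin) : G.value σ τ x = G.value σ τ (τ.toFun x) := by
  conv_lhs => rw [← value_fixed, F_min _ _ _ _ hx]

lemma value_rand (G : SSG V) (σ : G.MaxStrategy) (τ : G.MinStrategy) {x : V}
    (hx : x ∈ G.VR) : (G.value σ τ x : ℝ) = ∑ y, G.prob x y * (G.value σ τ y : ℝ) := by
  conv_lhs => rw [← value_fixed, F_rand _ _ _ _ hx]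

lemma value_sink (G : SSG V) (σ : G.MaxStrategy) (τ : G.MinStrategy) {x : V}
    (hx : x ∈ G.VS) : (G.value σ τ x : ℝ) = G.val x := by
  conv_lhs => rw [← value_fixed, F_sink _ _ _ _ hx]

/-- A best response is locally optimal at MIN vertices. -/
lemma IsBestResponse.le_succ {G : SSG V} {σ : G.MaxStrategy} {τ : G.MinStrategy}
    (h : G.IsBestResponse σ τ) {x y : V} (hx : x ∈ G.VMin) (hy : y ∈ G.succ x) :
    G.value σ τ x ≤ G.value σ τ y := by
  by_contra hlt
  push Not at hlt
  let τ₂ : G.MinStrategy :=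
    { toFun := Function.update τ.toFun x y
      mem_succ := by
        intro z hz
        by_cases hzx : z = x
        · subst hzx; simpa using hy
        · simpa [Function.update_of_ne hzx] using τ.mem_succ z hz
      eq_id := by
        intro z hz
        have hzx : z ≠ x := fun e => hz (e ▸ hx)
        simpa [Function.update_of_ne hzx] using τ.eq_id z hz }
  have hx2 : τ₂.toFun x = y := by simp [τ₂]
  have hle : G.value σ τ₂ ≤ G.value σ τ := by
    apply value_le
    intro z
    by_cases hzx : z = x
    · subst hzx
      rw [F_min _ _ _ _ hx, hx2]; exact hlt.le
    · have hz2 : τ₂.toFun z = τ.toFun z := by simp [τ₂, Function.update_of_ne hzx]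
      have : G.F σ τ₂ (G.value σ τ) z = G.F σ τ (G.value σ τ) z := by
        simp only [F, hz2]
      rw [this, value_fixed]
  have heq : G.value σ τ₂ = G.value σ τ := le_antisymm hle (h τ₂)
  have := value_min G σ τ₂ hx
  rw [hx2, heq] at this
  exact absurd this hlt.ne'

/-- A trap without sinks has value zero. -/
lemma value_eq_zero_of_trap (G : SSG V) (σ : G.MaxStrategy) (τ : G.MinStrategy) (A : Set V)
    (hM : ∀ x ∈ A, x ∈ G.VMax → σ.toFun x ∈ A) (hN : ∀ x ∈ A, x ∈ G.VMin → τ.toFun x ∈ A)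
    (hR : ∀ x ∈ A, x ∈ G.VR → ∀ y, G.prob x y ≠ 0 → y ∈ A) (hS : ∀ x ∈ A, x ∉ G.VS) :
    ∀ x ∈ A, G.value σ τ x = 0 := by
  classical
  have key : G.value σ τ ≤ fun x => if x ∈ A then 0 else 1 := by
    apply value_le
    intro x
    by_cases hA : x ∈ A
    · apply le_of_eq
      simp only [hA, if_true]
      rcases G.cover x with hx | hx | hx | hx
      · rw [F_max _ _ _ _ hx]; simp [hM x hA hx]
      · rw [F_min _ _ _ _ hx]; simp [hN x hA hx]
      · apply Subtype.ext
        rw [F_rand _ _ _ _ hx]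
        apply Finset.sum_eq_zero
        intro y _
        by_cases hp : G.prob x y = 0
        · simp [hp]
        · simp [hR x hA hx y hp]
      · exact absurd hx (hS x hA)
    · simp only [hA, if_false]
      exact unitInterval.le_one'
  intro x hx
  have := key x
  simp only [hx, if_true] at this
  exact le_antisymm this unitInterval.nonneg'

end SSG

/-- in a binary SSG, `v_{σ'} > v_σ` implies `S_σ \ S_{σ'}` is nonempty. -/
theorem switchSet_diff_nonempty_of_value_lt {V : Type*} [Fintype V] [DecidableEq V]
    (G : SSG V) (hbin : G.Binary) (σ σ' : G.MaxStrategy) (τ τ' : G.MinStrategy)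
    (hbr : G.IsBestResponse σ τ) (hbr' : G.IsBestResponse σ' τ')
    (hlt : G.value σ τ < G.value σ' τ') :
    (G.switchSet σ τ \ G.switchSet σ' τ').Nonempty := by
  classical
  by_contra hne
  have hsub : G.switchSet σ τ ⊆ G.switchSet σ' τ' := by
    rwa [Set.not_nonempty_iff_eq_empty, Set.sdiff_eq_empty] at hne
  obtain ⟨-, x₀, hx₀⟩ := Pi.lt_def.1 hlt
  let D : V → ℝ := fun x => (G.value σ' τ' x : ℝ) - (G.value σ τ x : ℝ)
  have hD : ∀ x, D x = (G.value σ' τ' x : ℝ) - (G.value σ τ x : ℝ) := fun _ => rfl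
  have : Nonempty V := ⟨x₀⟩
  obtain ⟨a, ha⟩ := Finite.exists_max D
  have hpos : 0 < D a := lt_of_lt_of_le (sub_pos.2 (Subtype.coe_lt_coe.2 hx₀)) (ha x₀)
  have hzero := G.value_eq_zero_of_trap σ' τ {x | D a ≤ D x} ?_ ?_ ?_ ?_ a (le_refl (D a))
  · have h1 := hbr' τ a
    rw [hzero, ← Subtype.coe_le_coe] at h1
    have h2 := (G.value σ τ a).2.1
    have h3 := hD a
    simp at h1
    linarith
  · intro x hxA hx
    simp only [Set.mem_ofPred_eq] at hxA ⊢
    by_cases hs : x ∈ G.switchSet σ τ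
    · obtain ⟨-, y, hy, hlt'⟩ := hsub hs
      have hyne : y ≠ σ'.toFun x := by
        rintro rfl
        exact absurd (G.value_max σ' τ' hx) hlt'.ne
      have hc := ha (σ.toFun x)
      have e := congrArg Subtype.val (G.value_max σ τ hx)
      have hσ : σ.toFun x = σ'.toFun x := by
        by_contra hcon
        have hσy : σ.toFun x = y := by
          by_contra h2
          have : ({σ.toFun x, σ'.toFun x, y} : Finset V) ⊆ G.succ x := by
            intro z hz
            simp only [Finset.mem_insert, Finset.mem_singleton] at hz
            rcases hz with rfl | rfl | rfl
            · exact σ.mem_succ x hx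
            · exact σ'.mem_succ x hx
            · exact hy
          have h3 := Finset.card_le_card this
          rw [hbin x hx, Finset.card_eq_three.2 ⟨_, _, _, hcon, h2, hyne.symm, rfl⟩] at h3
          omega
        rw [hD x, e] at hxA
        rw [hD (σ.toFun x)] at hc
        rw [← hσy, ← Subtype.coe_lt_coe] at hlt'
        linarith
      rw [← hσ]
      have h4 := congrArg Subtype.val (G.value_max σ' τ' hx)
      rw [← hσ] at h4
      rw [hD x, e, h4] at hxA
      exact hxA
    · have h1 : ¬ G.value σ τ x < G.value σ τ (σ'.toFun x) := fun h =>
        hs ⟨hx, _, σ'.mem_succ x hx, h⟩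
      rw [← Subtype.coe_lt_coe] at h1
      have e := congrArg Subtype.val (G.value_max σ' τ' hx)
      rw [hD x, e] at hxA
      rw [hD (σ'.toFun x)]
      linarith
  · intro x hxA hx
    simp only [Set.mem_ofPred_eq] at hxA ⊢
    have h1 := Subtype.coe_le_coe.2 (hbr'.le_succ hx (τ.mem_succ x hx))
    have e := congrArg Subtype.val (G.value_min σ τ hx)
    rw [hD x, e] at hxA
    rw [hD (τ.toFun x)]
    linarith
  · intro x hxA hx y hp
    simp only [Set.mem_ofPred_eq] at hxA ⊢
    by_contra hy
    push Not at hy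
    have h1 : D x = ∑ z, G.prob x z * D z := by
      simp only [hD, mul_sub, Finset.sum_sub_distrib]
      rw [← G.value_rand σ τ hx, ← G.value_rand σ' τ' hx]
    have h2 : ∑ z, G.prob x z * D z < ∑ z, G.prob x z * D a := by
      apply Finset.sum_lt_sum
      · intro z _
        exact mul_le_mul_of_nonneg_left (ha z) (G.prob_nonneg x z)
      · exact ⟨y, Finset.mem_univ _,
          mul_lt_mul_of_pos_left hy (lt_of_le_of_ne (G.prob_nonneg x y) (Ne.symm hp))⟩
    rw [← Finset.sum_mul, G.prob_sum x hx, one_mul] at h2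
    linarith
  · intro x hxA hx
    simp only [Set.mem_ofPred_eq] at hxA
    rw [hD x, G.value_sink σ τ hx, G.value_sink σ' τ' hx] at hxA
    linarith
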